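/- arXiv:0706.3338 — 2 statements merged into one kernel-verified Lean document; each statement's English description precedes it below -/
import Mathlib

section
/- Let H be a group and P = ⟨x, H; R⟩ a relative one-relator presentation whose x-skeleton W has the unique max-min property (i.e. P is an M_H-presentation). Then the natural homomorphism ν : H → G(P) is injective. -/
open Monoid

section Defs
variable {X Y H : Type*}

/-- `φ_W^θ(j)`: the sum `Σ_{i=1}^{j} ε_i θ(x_i)` of the weights of the first `j`
letters of the word `W` (a word is a nonempty list of pairs (letter, exponent sign)). -/
def phiW (θ : X → ℤ) (W : List (X × Bool)) (j : ℕ) : ℤ :=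
  ((W.take j).map fun p => if p.2 then θ p.1 else -θ p.1).sum

/-- A weight function: a map `θ : X → ℤ` whose image generates the additive group `ℤ`. -/
def IsWeightFun (θ : X → ℤ) : Prop :=
  AddSubgroup.closure (Set.range θ) = ⊤

/-- A strict weight function: `θ x ≠ 0` for all `x`. -/
def IsStrictWeight (θ : X → ℤ) : Prop := ∀ x, θ x ≠ 0

/-- `θ` is admissible for `W` if `φ(r) = 0` where `r` is the length of `W`. -/
def IsAdmissible (θ : X → ℤ) (W : List (X × Bool)) : Prop :=
  phiW θ W W.length = 0

/-- The successor of an index, cyclically (subscripts mod `r`). -/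
def succIdx (W : List (X × Bool)) (k : Fin W.length) : Fin W.length :=
  ⟨(k.1 + 1) % W.length, Nat.mod_lt _ k.pos⟩

/-- `W` has the unique max-min property with respect to the weight function `θ`:
`θ` is a strict weight function, admissible for `W`, the graph of `W` has a unique
maximum at `k` and a unique minimum at `l`, and `W` is reduced at the maximum and
minimum (`x_k ≠ x_{k+1}`, `x_l ≠ x_{l+1}`, subscripts mod `r`). -/
def UniqueMaxMinWith (θ : X → ℤ) (W : List (X × Bool)) : Prop :=
  W ≠ [] ∧ IsWeightFun θ ∧ IsStrictWeight θ ∧ IsAdmissible θ W ∧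
  ∃ k l : Fin W.length,
    (∀ j : Fin W.length, j ≠ k → phiW θ W (j.1 + 1) < phiW θ W (k.1 + 1)) ∧
    (∀ j : Fin W.length, j ≠ l → phiW θ W (l.1 + 1) < phiW θ W (j.1 + 1)) ∧
    (W.get k).1 ≠ (W.get (succIdx W k)).1 ∧
    (W.get l).1 ≠ (W.get (succIdx W l)).1

/-- `W` has the unique max-min property: it has it with respect to some
admissible strict weight function. -/
def HasUniqueMaxMin (W : List (X × Bool)) : Prop :=
  ∃ θ : X → ℤ, UniqueMaxMinWith θ W

/-- The `x`-skeleton of a relator `R = x₁^{ε₁} h₁ ⋯ x_r^{ε_r} h_r`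
(encoded as the list of triples `(xᵢ, εᵢ, hᵢ)`): the word `x₁^{ε₁} ⋯ x_r^{ε_r}`. -/
def skel (R : List (X × Bool × H)) : List (X × Bool) :=
  R.map fun t => (t.1, t.2.1)

variable [Group H]

/-- The element of the free product `H ∗ F(X)` represented by the relator
`R = x₁^{ε₁} h₁ ⋯ x_r^{ε_r} h_r`. -/
def relWord (R : List (X × Bool × H)) : Coprod H (FreeGroup X) :=
  (R.map fun t => Coprod.inr (FreeGroup.mk [(t.1, t.2.1)]) * Coprod.inl t.2.2).prod

/-- The group `G(P)` defined by the relative one-relator presentation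
`P = ⟨x, H; R⟩`: the quotient of `H ∗ F(X)` by the normal closure of `R`. -/
def relGroup (R : List (X × Bool × H)) : Type _ :=
  Coprod H (FreeGroup X) ⧸ Subgroup.normalClosure {relWord R}

instance (R : List (X × Bool × H)) : Group (relGroup R) :=
  QuotientGroup.Quotient.group _

/-- The natural homomorphism `ν : H → G(P)`. -/
def natHom (R : List (X × Bool × H)) : H →* relGroup R :=
  (QuotientGroup.mk' _).comp Coprod.inl

end Defs

section EquationSystems

variable {V H ι : Type*} [Group H]

/-- The value in `H` of a word `v₁^{ε₁} h₁ ⋯ v_r^{ε_r} h_r` under an assignment of its variables. -/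
def evalWord (f : V → H) (w : List (V × Bool × H)) : H :=
  (w.map fun t => (if t.2.1 then f t.1 else (f t.1)⁻¹) * t.2.2).prod

theorem evalWord_cons (f : V → H) (t : V × Bool × H) (w : List (V × Bool × H)) :
    evalWord f (t :: w) = (if t.2.1 then f t.1 else (f t.1)⁻¹) * t.2.2 * evalWord f w := by
  simp [evalWord]

theorem evalWord_append (f : V → H) (w₁ w₂ : List (V × Bool × H)) :
    evalWord f (w₁ ++ w₂) = evalWord f w₁ * evalWord f w₂ := by
  simp [evalWord]

theorem evalWord_congr {f g : V → H} {w : List (V × Bool × H)} (h : ∀ t ∈ w, f t.1 = g t.1) :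
    evalWord f w = evalWord g w := by
  unfold evalWord
  congr 1
  exact List.map_congr_left fun t ht => by rw [h t ht]

open Classical in
/-- An equation over a group in which some variable occurs exactly once can be solved for it. -/
theorem exists_evalWord_update_eq_one (f : V → H) (w : List (V × Bool × H)) (k : ℕ)
    (hk : k < w.length) (once : ∀ j (hj : j < w.length), w[j].1 = w[k].1 → j = k) :
    ∃ y, evalWord (Function.update f w[k].1 y) w = 1 := by
  have hw : w = w.take k ++ w[k] :: w.drop (k + 1) := by simp
  have before : ∀ y, evalWord (Function.update f w[k].1 y) (w.take k) = evalWord f (w.take k) := by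
    refine fun y => evalWord_congr fun t ht => Function.update_of_ne ?_ _ _
    obtain ⟨j, hj, rfl⟩ := List.mem_iff_getElem.1 ht
    rw [List.length_take] at hj
    rw [List.getElem_take]
    intro h
    have := once j (by omega) h
    omega
  have after : ∀ y, evalWord (Function.update f w[k].1 y) (w.drop (k + 1)) =
      evalWord f (w.drop (k + 1)) := by
    refine fun y => evalWord_congr fun t ht => Function.update_of_ne ?_ _ _
    obtain ⟨j, hj, rfl⟩ := List.mem_iff_getElem.1 ht
    rw [List.length_drop] at hj
    rw [List.getElem_drop]
    intro h
    have := once (k + 1 + j) (by omega) h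
    omega
  have split : ∀ y, evalWord (Function.update f w[k].1 y) w = evalWord f (w.take k) *
      ((if w[k].2.1 then y else y⁻¹) * w[k].2.2 * evalWord f (w.drop (k + 1))) := by
    intro y
    conv_lhs => arg 2; rw [hw]
    rw [evalWord_append, evalWord_cons, before, after, Function.update_self]
  set a := evalWord f (w.take k)
  set b := evalWord f (w.drop (k + 1))
  cases hε : w[k].2.1 with
  | true =>
    refine ⟨a⁻¹ * b⁻¹ * w[k].2.2⁻¹, ?_⟩
    rw [split, hε]
    simp [mul_assoc]
  | false =>
    refine ⟨w[k].2.2 * b * a, ?_⟩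
    rw [split, hε]
    simp [mul_assoc]

/-- A triangular system of equations over a group is solvable: each equation `w i` has a variable
occurring exactly once in it, and that variable appears in no other equation of smaller or
equal rank. -/
theorem exists_evalWord_eq_one_of_triangular (rank : ι → ℕ) (w : ι → List (V × Bool × H))
    (v : ι → V)
    (once : ∀ i, ∃ (k : ℕ) (hk : k < (w i).length), (w i)[k].1 = v i ∧
      ∀ j (hj : j < (w i).length), (w i)[j].1 = (w i)[k].1 → j = k)
    (triangular : ∀ i j, ∀ t ∈ w i, t.1 = v j → j = i ∨ rank j < rank i) :
    ∃ f : V → H, ∀ i, evalWord f (w i) = 1 := by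
  classical
  have solve : ∀ i (f : V → H), ∃ y, evalWord (Function.update f (v i) y) (w i) = 1 := by
    intro i f
    obtain ⟨k, hk, hv, h⟩ := once i
    rw [← hv]
    exact exists_evalWord_update_eq_one f _ k hk h
  choose sol hsol using solve
  have mem : ∀ i, ∃ t ∈ w i, t.1 = v i := fun i =>
    let ⟨_, hk, hv, _⟩ := once i
    ⟨_, List.getElem_mem hk, hv⟩
  have inj : Function.Injective v := by
    intro i j hij
    obtain ⟨s, hs, hsv⟩ := mem i
    obtain ⟨t, ht, htv⟩ := mem j
    rcases triangular i j s hs (hsv.trans hij) with h | h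
    · exact h.symm
    rcases triangular j i t ht (htv.trans hij.symm) with h' | h'
    · exact h'
    · omega
  let wf : WellFounded fun i j => rank i < rank j := (measure rank).wf
  let lower (i : ι) (prev : ∀ j, rank j < rank i → H) (u : V) : H :=
    if h : ∃ j, rank j < rank i ∧ v j = u then prev h.choose h.choose_spec.1 else 1
  let y : ι → H := wf.fix fun i prev => sol i (lower i prev)
  have hy : ∀ i, y i = sol i (lower i fun j _ => y j) := fun i => wf.fix_eq _ i
  let f : V → H := fun u => if h : ∃ j, v j = u then y h.choose else 1
  have hf : ∀ j, f (v j) = y j := by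
    intro j
    have h : ∃ j', v j' = v j := ⟨j, rfl⟩
    change (if h : ∃ j', v j' = v j then y h.choose else 1) = y j
    rw [dif_pos h, inj h.choose_spec]
  refine ⟨f, fun i => ?_⟩
  rw [← hsol i (lower i fun j _ => y j), ← hy]
  refine evalWord_congr fun t ht => ?_
  by_cases hti : t.1 = v i
  · rw [hti, hf, Function.update_self]
  rw [Function.update_of_ne hti]
  change f t.1 = if h : ∃ j, rank j < rank i ∧ v j = t.1 then y h.choose else 1
  by_cases h : ∃ j, v j = t.1
  · obtain ⟨j, hj⟩ := h
    have hlt : rank j < rank i := (triangular i j t ht hj.symm).resolve_left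
      fun e => hti (by rw [← hj, e])
    have h' : ∃ j, rank j < rank i ∧ v j = t.1 := ⟨j, hlt, hj⟩
    rw [dif_pos h', ← hf, h'.choose_spec.2]
  · rw [dif_neg fun ⟨j, hj⟩ => h ⟨j, hj.2⟩]
    exact dif_neg h

end EquationSystems

section WeightedWords

variable {X H : Type*}

/-- The weight of a letter `x^{ε}`. -/
def letterWeight (θ : X → ℤ) (x : X) (ε : Bool) : ℤ := if ε then θ x else -θ x

/-- The word over `X × ℤ` read along the path in `ℤ` that starts at height `p` and follows the
relator `R`; an edge labelled `x` is named by the height at which `x` is read positively. -/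
def edgeWord (θ : X → ℤ) : List (X × Bool × H) → ℤ → List ((X × ℤ) × Bool × H)
  | [], _ => []
  | (x, ε, h) :: R, p =>
    ((x, if ε then p else p + letterWeight θ x ε), ε, h) ::
      edgeWord θ R (p + letterWeight θ x ε)

theorem length_edgeWord (θ : X → ℤ) (R : List (X × Bool × H)) (p : ℤ) :
    (edgeWord θ R p).length = R.length := by
  induction R generalizing p with
  | nil => rfl
  | cons t R ih => simp [edgeWord, ih]

theorem phiW_skel_cons_succ (θ : X → ℤ) (t : X × Bool × H) (R : List (X × Bool × H)) (j : ℕ) :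
    phiW θ (skel (t :: R)) (j + 1) = letterWeight θ t.1 t.2.1 + phiW θ (skel R) j := by
  simp [phiW, skel, letterWeight]

theorem phiW_zero (θ : X → ℤ) (W : List (X × Bool)) : phiW θ W 0 = 0 := by
  simp [phiW]

theorem edgeWord_getElem (θ : X → ℤ) (R : List (X × Bool × H)) (p : ℤ) (i : ℕ)
    (hi : i < R.length) (hi' : i < (edgeWord θ R p).length) :
    (edgeWord θ R p)[i].1.1 = R[i].1 ∧
      (((edgeWord θ R p)[i].1.2 = p + phiW θ (skel R) i ∧
        (edgeWord θ R p)[i].1.2 + θ R[i].1 = p + phiW θ (skel R) (i + 1)) ∨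
      ((edgeWord θ R p)[i].1.2 = p + phiW θ (skel R) (i + 1) ∧
        (edgeWord θ R p)[i].1.2 + θ R[i].1 = p + phiW θ (skel R) i)) := by
  induction R generalizing p i with
  | nil => simp at hi
  | cons t R ih =>
    obtain ⟨x, ε, h⟩ := t
    cases i with
    | zero =>
      cases ε <;> simp [edgeWord, phiW_skel_cons_succ, phiW_zero, letterWeight]
    | succ i =>
      have := ih (p + letterWeight θ x ε) i (by simpa using hi) (by simpa [edgeWord] using hi')
      simpa only [edgeWord, List.getElem_cons_succ, phiW_skel_cons_succ, ← add_assoc] using this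

variable [Group H]

theorem exists_evalWord_edgeWord_eq_one (θ : X → ℤ) (R : List (X × Bool × H))
    (h0 : IsAdmissible θ (skel R)) (k l : Fin (skel R).length)
    (hk : ∀ j, j ≠ k → phiW θ (skel R) (j.1 + 1) < phiW θ (skel R) (k.1 + 1))
    (hl : ∀ j, j ≠ l → phiW θ (skel R) (l.1 + 1) < phiW θ (skel R) (j.1 + 1))
    (hxk : ((skel R).get k).1 ≠ ((skel R).get (succIdx (skel R) k)).1)
    (hxl : ((skel R).get l).1 ≠ ((skel R).get (succIdx (skel R) l)).1) :
    ∃ f : X × ℤ → H, ∀ p, evalWord f (edgeWord θ R p) = 1 := by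
  have len : (skel R).length = R.length := by simp [skel]
  have hkR : k.1 < R.length := len ▸ k.2
  have hlR : l.1 < R.length := len ▸ l.2
  have letter : ∀ i (hi : i < R.length) (hi' : i < (skel R).length),
      ((skel R)[i]).1 = R[i].1 := by
    intro i hi hi'
    simp [skel]
  -- extremal heights are only met next to the extremal letters
  have closed : ∀ i, i ≤ R.length → ∃ j : Fin (skel R).length,
      phiW θ (skel R) i = phiW θ (skel R) (j.1 + 1) ∧
      (i < R.length → i = (j.1 + 1) % (skel R).length) := by
    intro i hi
    cases i with
    | zero =>
      refine ⟨⟨(skel R).length - 1, by have := k.2; omega⟩, ?_, fun _ => ?_⟩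
      · have e : (skel R).length - 1 + 1 = (skel R).length := by have := k.2; omega
        simp only [e, phiW_zero]
        exact h0.symm
      · have e : (skel R).length - 1 + 1 = (skel R).length := by have := k.2; omega
        simp only [e, Nat.mod_self]
    | succ i =>
      refine ⟨⟨i, by omega⟩, rfl, fun h => ?_⟩
      exact (Nat.mod_eq_of_lt (by simpa [len] using h)).symm
  set φ := phiW θ (skel R) with hφ
  have le_max : ∀ i, i ≤ R.length → φ i ≤ φ (k.1 + 1) := by
    intro i hi
    obtain ⟨j, hj, -⟩ := closed i hi
    rw [hj]
    by_cases e : j = k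
    · rw [e]
    · exact (hk j e).le
  have min_le : ∀ i, i ≤ R.length → φ (l.1 + 1) ≤ φ i := by
    intro i hi
    obtain ⟨j, hj, -⟩ := closed i hi
    rw [hj]
    by_cases e : j = l
    · rw [e]
    · exact (hl j e).le
  have eq_max : ∀ i (hi : i < R.length), R[i].1 = R[k.1].1 →
      (φ i = φ (k.1 + 1) ∨ φ (i + 1) = φ (k.1 + 1)) → i = k.1 := by
    intro i hi hx h
    rcases h with h | h
    · exfalso
      obtain ⟨j, hj, hij⟩ := closed i hi.le
      have e : j = k := by
        by_contra e
        have := hk j e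
        omega
      subst e
      apply hxk
      have := hij hi
      simp only [succIdx, List.get_eq_getElem, ← this]
      rw [letter _ hkR, letter _ hi, hx]
    · by_contra e
      have := hk ⟨i, by omega⟩ (fun h' => e (by rw [← h']))
      simp only at this
      omega
  have eq_min : ∀ i (hi : i < R.length), R[i].1 = R[l.1].1 →
      (φ i = φ (l.1 + 1) ∨ φ (i + 1) = φ (l.1 + 1)) → i = l.1 := by
    intro i hi hx h
    rcases h with h | h
    · exfalso
      obtain ⟨j, hj, hij⟩ := closed i hi.le
      have e : j = l := by
        by_contra e
        have := hl j e
        omega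
      subst e
      apply hxl
      have := hij hi
      simp only [succIdx, List.get_eq_getElem, ← this]
      rw [letter _ hlR, letter _ hi, hx]
    · by_contra e
      have := hl ⟨i, by omega⟩ (fun h' => e (by rw [← h']))
      simp only at this
      omega
  have lenE : ∀ p, (edgeWord θ R p).length = R.length := length_edgeWord θ R
  let pivot : ℤ → ℕ := fun p => if 0 ≤ p then k.1 else l.1
  have hpivot : ∀ p, pivot p < R.length := by
    intro p
    simp only [pivot]
    split_ifs <;> assumption
  have hpivotE : ∀ p, pivot p < (edgeWord θ R p).length := fun p => by rw [lenE]; exact hpivot p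
  have coincide : ∀ p q i j (hi : i < R.length) (hj : j < R.length)
      (hi' : i < (edgeWord θ R p).length) (hj' : j < (edgeWord θ R q).length),
      (edgeWord θ R p)[i].1 = (edgeWord θ R q)[j].1 → R[i].1 = R[j].1 ∧
        ((p + φ i = q + φ j ∧ p + φ (i + 1) = q + φ (j + 1)) ∨
          (p + φ i = q + φ (j + 1) ∧ p + φ (i + 1) = q + φ j)) := by
    intro p q i j hi hj hi' hj' h
    obtain ⟨hx, hp⟩ := edgeWord_getElem θ R p i hi hi'
    obtain ⟨hx', hq⟩ := edgeWord_getElem θ R q j hj hj'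
    have e : R[i].1 = R[j].1 := by rw [← hx, ← hx', h]
    refine ⟨e, ?_⟩
    rw [h, e] at hp
    simp only [← hφ] at hp hq
    omega
  refine exists_evalWord_eq_one_of_triangular Int.natAbs (edgeWord θ R)
    (fun p => (edgeWord θ R p)[pivot p]'(hpivotE p) |>.1) (fun p => ?_) (fun p q t ht htq => ?_)
  · refine ⟨pivot p, hpivotE p, rfl, fun j hj h => ?_⟩
    have hjR : j < R.length := lenE p ▸ hj
    obtain ⟨hx, hc⟩ := coincide p p j (pivot p) hjR (hpivot p) hj (hpivotE p) h
    by_cases hp : 0 ≤ p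
    · have e : pivot p = k.1 := if_pos hp
      simp only [e] at hx hc ⊢
      exact eq_max j hjR hx (by omega)
    · have e : pivot p = l.1 := if_neg hp
      simp only [e] at hx hc ⊢
      exact eq_min j hjR hx (by omega)
  · obtain ⟨i, hi, rfl⟩ := List.mem_iff_getElem.1 ht
    have hiR : i < R.length := lenE p ▸ hi
    obtain ⟨-, hc⟩ := coincide p q i (pivot q) hiR (hpivot q) hi (hpivotE q) htq
    have h1 := le_max i hiR.le
    have h2 := le_max (i + 1) hiR
    have h3 := min_le i hiR.le
    have h4 := min_le (i + 1) hiR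
    by_cases hq : 0 ≤ q
    · have e : pivot q = k.1 := if_pos hq
      rw [e] at hc
      omega
    · have e : pivot q = l.1 := if_neg hq
      rw [e] at hc
      omega

/-- The permutation of `H × ℤ` by which a letter `x` acts, for a labelling `f` of the edges:
it moves from height `n` to height `n - θ x`. -/
def edgePerm (θ : X → ℤ) (f : X × ℤ → H) (x : X) : Equiv.Perm (H × ℤ) where
  toFun a := (f (x, a.2 - θ x) * a.1, a.2 - θ x)
  invFun a := ((f (x, a.2))⁻¹ * a.1, a.2 + θ x)
  left_inv a := by simp
  right_inv a := by simp

/-- The permutation of `H × ℤ` by left translation of the first factor. -/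
def translationHom : H →* Equiv.Perm (H × ℤ) where
  toFun h := (Equiv.mulLeft h).prodCongr (Equiv.refl ℤ)
  map_one' := by ext a <;> simp
  map_mul' g h := by ext a <;> simp [mul_assoc]

/-- The action of `H ∗ F(X)` on `H × ℤ` determined by a labelling of the edges. -/
def edgeAction (θ : X → ℤ) (f : X × ℤ → H) : Coprod H (FreeGroup X) →* Equiv.Perm (H × ℤ) :=
  Coprod.lift translationHom (FreeGroup.lift (edgePerm θ f))

theorem edgeAction_inl_apply (θ : X → ℤ) (f : X × ℤ → H) (h : H) (a : H × ℤ) :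
    edgeAction θ f (Coprod.inl h) a = (h * a.1, a.2) := by
  simp [edgeAction, translationHom, Prod.map]

theorem edgeAction_relWord_apply (θ : X → ℤ) (f : X × ℤ → H) (R : List (X × Bool × H))
    (g : H) (p : ℤ) :
    edgeAction θ f (relWord R) (g, p + phiW θ (skel R) (skel R).length) =
      (evalWord f (edgeWord θ R p) * g, p) := by
  induction R generalizing p with
  | nil => simp [relWord, skel, phiW, edgeWord, evalWord]
  | cons t R ih =>
    obtain ⟨x, ε, h⟩ := t
    have hrel : relWord ((x, ε, h) :: R) =
        Coprod.inr (FreeGroup.mk [(x, ε)]) * Coprod.inl h * relWord R := by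
      simp [relWord]
    have hlen : (skel ((x, ε, h) :: R)).length = (skel R).length + 1 := by simp [skel]
    rw [hrel, hlen, phiW_skel_cons_succ, ← add_assoc, map_mul, map_mul, Equiv.Perm.mul_apply,
      Equiv.Perm.mul_apply, ih, edgeAction_inl_apply, edgeWord, evalWord_cons]
    cases ε <;>
      simp [edgeAction, edgePerm, letterWeight, mul_assoc, Equiv.Perm.inv_def]

theorem natHom_injective_of_evalWord_edgeWord (θ : X → ℤ) (R : List (X × Bool × H))
    (h0 : IsAdmissible θ (skel R)) (f : X × ℤ → H)
    (hf : ∀ p, evalWord f (edgeWord θ R p) = 1) :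
    Function.Injective (natHom R) := by
  have hR : relWord R ∈ (edgeAction θ f).ker := by
    rw [MonoidHom.mem_ker]
    refine Equiv.ext fun a => ?_
    have h := edgeAction_relWord_apply θ f R a.1 a.2
    rw [show phiW θ (skel R) (skel R).length = 0 from h0, add_zero, hf, one_mul] at h
    exact h
  have hker : Subgroup.normalClosure {relWord R} ≤ (edgeAction θ f).ker :=
    Subgroup.normalClosure_le_normal (Set.singleton_subset_iff.2 hR)
  rw [injective_iff_map_eq_one]
  intro h hh
  have hmem : Coprod.inl h ∈ Subgroup.normalClosure {relWord R} :=
    (QuotientGroup.eq_one_iff _).1 hh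
  have h1 : edgeAction θ f (Coprod.inl h) (1, 0) = (1, 0) := by
    rw [MonoidHom.mem_ker.1 (hker hmem), Equiv.Perm.one_apply]
  rw [edgeAction_inl_apply] at h1
  simpa using congrArg Prod.fst h1

end WeightedWords

/-- **Theorem 1(i)** (Pride). If `P = ⟨x, H; R⟩` is a relative one-relator
presentation whose `x`-skeleton has the unique max-min property (an
`M_H`-presentation), then the natural homomorphism `ν : H → G(P)` is injective. -/
theorem natHom_injective_of_hasUniqueMaxMin {X H : Type*} [Group H]
    (R : List (X × Bool × H)) (hP : HasUniqueMaxMin (skel R)) :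
    Function.Injective (natHom R) := by
  obtain ⟨θ, -, -, -, h0, k, l, hk, hl, hxk, hxl⟩ := hP
  obtain ⟨f, hf⟩ := exists_evalWord_edgeWord_eq_one θ R h0 k l hk hl hxk hxl
  exact natHom_injective_of_evalWord_edgeWord θ R h0 f hf
end

section
/- Let H be a group and P = ⟨x, H; R⟩ a relative one-relator presentation whose x-skeleton W has the unique max-min property (i.e. P is an M_H-presentation). Then G(P) is residually finite if and only if H is residually finite. -/
open Monoid

/-- A group is residually finite if every nontrivial element is sent to a
nontrivial element by some homomorphism to a finite group. -/
def ResiduallyFinite (G : Type*) [Group G] : Prop :=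
  ∀ g : G, g ≠ 1 → ∃ (Q : Type) (_ : Group Q) (_ : Finite Q) (f : G →* Q), f g ≠ 1

section ResiduallyFinite

/-- Residual finiteness passes along injective homomorphisms. -/
theorem ResiduallyFinite.of_injective {G K : Type*} [Group G] [Group K]
    (hG : ResiduallyFinite G) (f : K →* G) (hf : Function.Injective f) : ResiduallyFinite K := by
  intro k hk
  obtain ⟨Q, _, _, q, hq⟩ := hG (f k) (by simpa [map_eq_one_iff f hf] using hk)
  exact ⟨Q, inferInstance, inferInstance, q.comp f, hq⟩

theorem residuallyFinite_multiplicative_int : ResiduallyFinite (Multiplicative ℤ) := by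
  intro g hg
  have hz : g.toAdd ≠ 0 := hg
  have : NeZero (g.toAdd.natAbs + 1) := ⟨by omega⟩
  refine ⟨Multiplicative (ZMod (g.toAdd.natAbs + 1)), inferInstance, inferInstance,
    AddMonoidHom.toMultiplicative (Int.castAddHom _), fun h => ?_⟩
  have h' : ((g.toAdd : ℤ) : ZMod (g.toAdd.natAbs + 1)) = 0 := h
  rw [ZMod.intCast_zmod_eq_zero_iff_dvd] at h'
  have := Int.natAbs_dvd_natAbs.mpr h'
  have := Nat.le_of_dvd (by omega) this
  omega

theorem ResiduallyFinite.prod {G K : Type*} [Group G] [Group K]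
    (hG : ResiduallyFinite G) (hK : ResiduallyFinite K) : ResiduallyFinite (G × K) := by
  rintro ⟨a, b⟩ hab
  by_cases ha : a = 1
  · obtain ⟨Q, _, _, q, hq⟩ := hK b (by rintro rfl; exact hab (by rw [ha]; rfl))
    exact ⟨Q, inferInstance, inferInstance, q.comp (MonoidHom.snd G K), hq⟩
  · obtain ⟨Q, _, _, q, hq⟩ := hG a ha
    exact ⟨Q, inferInstance, inferInstance, q.comp (MonoidHom.fst G K), hq⟩

/-- Finitely many nontrivial elements of a residually finite group survive simultaneously in some
finite quotient. -/
theorem ResiduallyFinite.exists_forall_ne_one {K : Type*} [Group K] (hK : ResiduallyFinite K)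
    (l : List K) (hl : ∀ k ∈ l, k ≠ 1) :
    ∃ (Q : Type) (_ : Group Q) (_ : Finite Q) (f : K →* Q), ∀ k ∈ l, f k ≠ 1 := by
  induction l with
  | nil => exact ⟨Unit, inferInstance, inferInstance, 1, by simp⟩
  | cons a l ih =>
    obtain ⟨Q₁, _, _, f₁, h₁⟩ := ih fun k hk => hl k (List.mem_cons_of_mem _ hk)
    obtain ⟨Q₂, _, _, f₂, h₂⟩ := hK a (hl a List.mem_cons_self)
    refine ⟨Q₁ × Q₂, inferInstance, inferInstance, f₁.prod f₂, fun k hk h => ?_⟩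
    rcases List.mem_cons.1 hk with rfl | hk
    · exact h₂ (congrArg Prod.snd h)
    · exact h₁ k hk (congrArg Prod.fst h)

variable {ι Q : Type*}

/-- The vertex identifications behind `residuallyFinite_coprodI`: the identity of the
`j`-th copy of `Q` goes to the `j + 1`-st point of a path, the element `q j` of that copy to the
`j`-th point. -/
noncomputable def pathEmb [One Q] {m : ℕ} (q : Fin m → Q) (p : Fin m × Q) :
    Fin (m + 1) ⊕ Fin m × Q :=
  open Classical in
  if p.2 = 1 then Sum.inl p.1.succ else if p.2 = q p.1 then Sum.inl p.1.castSucc else Sum.inr p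

theorem pathEmb_injOn [One Q] {m : ℕ} (q : Fin m → Q) (i : Fin m → ι)
    (hi : ∀ j j' : Fin m, j'.1 = j.1 + 1 → i j ≠ i j') (i₀ : ι) :
    Set.InjOn (pathEmb q) {p | i p.1 = i₀} := by
  rintro ⟨j, x⟩ hj ⟨j', x'⟩ hj' h
  have hij : i j = i j' := hj.trans hj'.symm
  have h₁ := fun e => hi j j' e hij
  have h₂ := fun e => hi j' j e hij.symm
  unfold pathEmb at h
  dsimp only at h
  split_ifs at h with hx hx' hx' hx' hx' hx'
  all_goals simp [Fin.ext_iff] at h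
  · simp [hx, hx', Fin.ext_iff, h]
  · exact (h₁ h.symm).elim
  · exact (h₂ h).elim
  · obtain rfl : j = j' := Fin.ext h
    simp_all
  · obtain ⟨h, rfl⟩ := h
    simp [Fin.ext_iff, h]

/-- A group acts on copies of itself by simultaneous left multiplication. -/
def mulLeftPerm (J Q : Type*) [Group Q] : Q →* Equiv.Perm (J × Q) where
  toFun x := (Equiv.refl J).prodCongr (Equiv.mulLeft x)
  map_one' := by ext <;> simp
  map_mul' x y := by ext <;> simp [mul_assoc]

/-- A free product of copies of a residually finite group is residually finite. -/
theorem residuallyFinite_coprodI {ι K : Type*} [Group K] (hK : ResiduallyFinite K) :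
    ResiduallyFinite (CoprodI fun _ : ι => K) := by
  classical
  intro g hg
  obtain ⟨w, rfl⟩ := (CoprodI.Word.equiv (M := fun _ : ι => K)).symm.surjective g
  change w.prod ≠ 1 at hg
  obtain ⟨Q, _, _, f, hf⟩ := hK.exists_forall_ne_one (w.toList.map fun l => l.2) (by
    intro k hk
    obtain ⟨l, hl, rfl⟩ := List.mem_map.1 hk
    exact w.ne_one l hl)
  set l := w.toList with hl
  let i : Fin l.length → ι := fun j => (l.get j).1
  let q : Fin l.length → Q := fun j => f (l.get j).2
  have hq (j) : q j ≠ 1 := hf _ (List.mem_map_of_mem (l.get_mem j))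
  have hi : ∀ j j' : Fin l.length, j'.1 = j.1 + 1 → i j ≠ i j' := by
    rintro ⟨j, hj⟩ ⟨j', hj'⟩ h
    obtain rfl : j' = j + 1 := h
    exact List.isChain_iff_getElem.1 w.chain_ne j hj'
  let β (i₀ : ι) : {j // i j = i₀} × Q ↪ Fin (l.length + 1) ⊕ Fin l.length × Q :=
    ⟨fun p => pathEmb q (p.1, p.2), by
      rintro ⟨j, x⟩ ⟨j', x'⟩ h
      have := pathEmb_injOn q i hi i₀ (show i j = i₀ from j.2) (show i j' = i₀ from j'.2) h
      simpa [Subtype.ext_iff] using this⟩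
  let ρ (i₀ : ι) : K →* Equiv.Perm (Fin (l.length + 1) ⊕ Fin l.length × Q) :=
    ((Equiv.Perm.viaEmbeddingHom (β i₀)).comp (mulLeftPerm _ Q)).comp f
  have key : ∀ n (hn : n ≤ l.length),
      CoprodI.lift ρ ((l.drop n).map fun t =>
        (CoprodI.of (i := t.1) t.2 : CoprodI fun _ : ι => K)).prod (Sum.inl (Fin.last _)) =
        Sum.inl ⟨n, by omega⟩ := by
    intro n hn
    induction hn using Nat.decreasingInduction with
    | self => simp [Fin.last]
    | of_succ n hn ih =>
      rw [List.drop_eq_getElem_cons hn, List.map_cons, List.prod_cons, map_mul,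
        Equiv.Perm.mul_apply, ih, CoprodI.lift_of]
      have e₁ : (Sum.inl ⟨n + 1, by omega⟩ : Fin (l.length + 1) ⊕ Fin l.length × Q) =
          β (l[n].1) (⟨⟨n, hn⟩, rfl⟩, 1) := by
        simp [β, pathEmb]
      have e₂ : (Sum.inl ⟨n, by omega⟩ : Fin (l.length + 1) ⊕ Fin l.length × Q) =
          β (l[n].1) (⟨⟨n, hn⟩, rfl⟩, q ⟨n, hn⟩) := by
        simp [β, pathEmb, hq]
      rw [e₁, e₂]
      simp only [ρ, MonoidHom.comp_apply, Equiv.Perm.viaEmbeddingHom_apply,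
        Equiv.Perm.viaEmbedding_apply]
      simp [mulLeftPerm, q]
  refine ⟨Equiv.Perm (Fin (l.length + 1) ⊕ Fin l.length × Q), inferInstance, inferInstance,
    CoprodI.lift ρ, fun h => hg ?_⟩
  have h₀ := key 0 (Nat.zero_le _)
  rw [List.drop_zero] at h₀
  change CoprodI.lift ρ w.prod = 1 at h
  unfold CoprodI.Word.prod at h
  rw [← hl] at h
  rw [h] at h₀
  have hlen : l.length = 0 := by simpa [Fin.ext_iff] using h₀
  unfold CoprodI.Word.prod
  rw [← hl, List.length_eq_zero_iff.1 hlen]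
  simp

end ResiduallyFinite

section Recursion

variable {Γ : Type*}

/-- A system of conditions `P i` (`i ∈ ℤ`) on two-sided sequences, the condition `P i` involving
only the entries in `[i + p, i + q]` and determining each of the two extreme entries in terms of
the others. -/
structure IsTwoSidedRecursion (p q : ℤ) (P : ℤ → (ℤ → Γ) → Prop) : Prop where
  lt : p < q
  congr : ∀ i u u', (∀ j, i + p ≤ j → j ≤ i + q → u j = u' j) → P i u → P i u'
  exists_top : ∀ i u, ∃ y, P i (Function.update u (i + q) y)
  unique_top : ∀ i u u', (∀ j, i + p ≤ j → j < i + q → u j = u' j) → P i u → P i u' →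
    u (i + q) = u' (i + q)
  exists_bot : ∀ i u, ∃ y, P i (Function.update u (i + p) y)
  unique_bot : ∀ i u u', (∀ j, i + p < j → j ≤ i + q → u j = u' j) → P i u → P i u' →
    u (i + p) = u' (i + p)

namespace IsTwoSidedRecursion

variable {p q : ℤ} {P : ℤ → (ℤ → Γ) → Prop}

/-- Two sequences that agree on a window and satisfy the first `n` conditions agree on the
correspondingly longer window. -/
theorem eq_of_forward (hP : IsTwoSidedRecursion p q P) {u u' : ℤ → Γ} (n : ℕ)
    (h : ∀ j, p ≤ j → j < q → u j = u' j) (hu : ∀ i, 0 ≤ i → i < n → P i u)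
    (hu' : ∀ i, 0 ≤ i → i < n → P i u') : ∀ j, p ≤ j → j < q + n → u j = u' j := by
  induction n with
  | zero => simpa using h
  | succ n ih =>
    push_cast at *
    have ih' := ih (fun i h₁ h₂ => hu i h₁ (by omega)) fun i h₁ h₂ => hu' i h₁ (by omega)
    intro j h₁ h₂
    by_cases hj : j < q + n
    · exact ih' j h₁ hj
    · obtain rfl : j = n + q := by omega
      exact hP.unique_top n u u' (fun j h₁ h₂ => ih' j (by omega) (by omega))
        (hu _ (by omega) (by omega)) (hu' _ (by omega) (by omega))

theorem eq_of_backward (hP : IsTwoSidedRecursion p q P) {u u' : ℤ → Γ} (n : ℕ)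
    (h : ∀ j, p ≤ j → j < q → u j = u' j) (hu : ∀ i, P i u)
    (hu' : ∀ i, P i u') : ∀ j, p - n ≤ j → j < q → u j = u' j := by
  induction n with
  | zero => simpa using h
  | succ n ih =>
    push_cast at *
    intro j h₁ h₂
    by_cases hj : p - n ≤ j
    · exact ih j hj h₂
    · obtain rfl : j = (-n - 1) + p := by omega
      exact hP.unique_bot (-n - 1) u u' (fun j h₁ h₂ => ih j (by omega) (by omega))
        (hu _) (hu' _)

/-- A solution is determined by its entries in a window. -/
theorem eq_of_window (hP : IsTwoSidedRecursion p q P) {u u' : ℤ → Γ}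
    (h : ∀ j, p ≤ j → j < q → u j = u' j) (hu : ∀ i, P i u) (hu' : ∀ i, P i u') : u = u' := by
  ext j
  by_cases hj : p ≤ j
  · exact hP.eq_of_forward (j - q + 1).toNat h (fun i _ _ => hu i) (fun i _ _ => hu' i) j hj
      (by omega)
  · exact hP.eq_of_backward (p - j).toNat h hu hu' j (by omega) (by have := hP.lt; omega)

theorem exists_step (hP : IsTwoSidedRecursion p q P) (k : ℕ) (u : ℤ → Γ)
    (hu : ∀ i : ℤ, -k ≤ i → i < k → P i u) :
    ∃ u' : ℤ → Γ, (∀ i : ℤ, -(k + 1 : ℕ) ≤ i → i < (k + 1 : ℕ) → P i u') ∧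
      ∀ j, p - k ≤ j → j < q + k → u' j = u j := by
  have hlt := hP.lt
  obtain ⟨y, hy⟩ := hP.exists_top k u
  obtain ⟨z, hz⟩ := hP.exists_bot (-k - 1) (Function.update u (k + q) y)
  refine ⟨Function.update (Function.update u (k + q) y) (-k - 1 + p) z, fun i h₁ h₂ => ?_,
    fun j h₁ h₂ => ?_⟩
  · rcases lt_trichotomy i (-k - 1) with h | rfl | h
    · push_cast at h₁; omega
    · exact hz
    · rcases lt_trichotomy i k with h' | rfl | h'
      · refine hP.congr i _ _ (fun j h₁ h₂ => ?_) (hu i (by omega) h')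
        rw [Function.update_of_ne (by omega), Function.update_of_ne (by omega)]
      · refine hP.congr _ _ _ (fun j h₁ h₂ => ?_) hy
        exact (Function.update_of_ne (by omega) _ _).symm
      · push_cast at h₂; omega
  · rw [Function.update_of_ne (by omega), Function.update_of_ne (by omega)]

/-- Every window extends to a solution. -/
theorem exists_solution (hP : IsTwoSidedRecursion p q P) (v : ℤ → Γ) :
    ∃ u : ℤ → Γ, (∀ i, P i u) ∧ ∀ j, p ≤ j → j < q → u j = v j := by
  choose F hF hF' using hP.exists_step
  let f : (k : ℕ) → {u : ℤ → Γ // ∀ i : ℤ, -k ≤ i → i < k → P i u} := fun k =>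
    Nat.rec ⟨v, fun i h₁ h₂ => by simp at h₁ h₂; omega⟩ (fun k u => ⟨F k u.1 u.2, hF k u.1 u.2⟩) k
  have hstep : ∀ (k : ℕ) (j : ℤ), p - k ≤ j → j < q + k → (f (k + 1)).1 j = (f k).1 j :=
    fun k j h₁ h₂ => hF' k (f k).1 (f k).2 j h₁ h₂
  have hstab : ∀ (k n : ℕ) (j : ℤ), p - k ≤ j → j < q + k → (f (k + n)).1 j = (f k).1 j := by
    intro k n j h₁ h₂
    induction n with
    | zero => rfl
    | succ n ih => rw [← add_assoc, hstep _ _ (by push_cast; omega) (by push_cast; omega), ih]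
  have hstab' : ∀ (k k' : ℕ) (j : ℤ), p - k ≤ j → j < q + k → p - k' ≤ j → j < q + k' →
      (f k).1 j = (f k').1 j := by
    intro k k' j h₁ h₂ h₃ h₄
    rcases le_total k k' with h | h
    · obtain ⟨n, rfl⟩ := Nat.exists_eq_add_of_le h
      exact (hstab k n j h₁ h₂).symm
    · obtain ⟨n, rfl⟩ := Nat.exists_eq_add_of_le h
      exact hstab k' n j h₃ h₄
  let B (j : ℤ) : ℕ := j.natAbs + p.natAbs + q.natAbs + 1
  refine ⟨fun j => (f (B j)).1 j, fun i => ?_, fun j h₁ h₂ => ?_⟩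
  · let k : ℕ := i.natAbs + p.natAbs + q.natAbs + 1
    refine hP.congr i _ _ (fun j h₁ h₂ => ?_) ((f k).2 i (by omega) (by omega))
    exact hstab' _ _ _ (by omega) (by omega) (by omega) (by omega)
  · exact hstab' (B j) 0 j (by omega) (by omega) (by simpa using h₁) (by simpa using h₂)

end IsTwoSidedRecursion

end Recursion

section Path

variable {X H Γ : Type*}

/-- The weight of a letter of a relative word. -/
def letterWt (θ : X → ℤ) (t : X × Bool × H) : ℤ := if t.2.1 then θ t.1 else -θ t.1

/-- The weight of a relative word. -/
def pathWt (θ : X → ℤ) (L : List (X × Bool × H)) : ℤ := (L.map (letterWt θ)).sum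

/-- The source of the edge traversed (forwards or backwards) by a letter read from the
vertex `i`. The edge of type `x` with source `s` runs from `s` to `s + θ x`. -/
def letterSrc (θ : X → ℤ) (i : ℤ) (t : X × Bool × H) : ℤ := if t.2.1 then i else i - θ t.1

/-- The edges, given by type and source, traversed by a relative word read from the vertex `i`. -/
def pathEdges (θ : X → ℤ) : ℤ → List (X × Bool × H) → List (X × ℤ)
  | _, [] => []
  | i, t :: L => (t.1, letterSrc θ i t) :: pathEdges θ (i + letterWt θ t) L

/-- The upper endpoint of an edge. -/
def edgeHi (θ : X → ℤ) (p : X × ℤ) : ℤ := max p.2 (p.2 + θ p.1)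

/-- The lower endpoint of an edge. -/
def edgeLo (θ : X → ℤ) (p : X × ℤ) : ℤ := min p.2 (p.2 + θ p.1)

@[simp] theorem pathWt_nil (θ : X → ℤ) : pathWt θ ([] : List (X × Bool × H)) = 0 := rfl

theorem pathWt_cons (θ : X → ℤ) (t : X × Bool × H) (L : List (X × Bool × H)) :
    pathWt θ (t :: L) = letterWt θ t + pathWt θ L := by simp [pathWt]

theorem pathWt_append (θ : X → ℤ) (L L' : List (X × Bool × H)) :
    pathWt θ (L ++ L') = pathWt θ L + pathWt θ L' := by simp [pathWt]

theorem edgeLo_le_edgeHi (θ : X → ℤ) (p : X × ℤ) : edgeLo θ p ≤ edgeHi θ p :=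
  min_le_max

theorem edgeHi_letter (θ : X → ℤ) (i : ℤ) (t : X × Bool × H) :
    edgeHi θ (t.1, letterSrc θ i t) = max i (i + letterWt θ t) := by
  unfold edgeHi letterSrc letterWt
  split_ifs <;> simp [max_comm, sub_eq_add_neg]

theorem edgeLo_letter (θ : X → ℤ) (i : ℤ) (t : X × Bool × H) :
    edgeLo θ (t.1, letterSrc θ i t) = min i (i + letterWt θ t) := by
  unfold edgeLo letterSrc letterWt
  split_ifs <;> simp [min_comm, sub_eq_add_neg]

theorem edgeHi_add (θ : X → ℤ) (x : X) (s k : ℤ) : edgeHi θ (x, s + k) = edgeHi θ (x, s) + k := by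
  simp only [edgeHi]; omega

theorem edgeLo_add (θ : X → ℤ) (x : X) (s k : ℤ) : edgeLo θ (x, s + k) = edgeLo θ (x, s) + k := by
  simp only [edgeLo]; omega

theorem letterSrc_add (θ : X → ℤ) (i k : ℤ) (t : X × Bool × H) :
    letterSrc θ (i + k) t = letterSrc θ i t + k := by
  unfold letterSrc; split_ifs <;> ring

theorem pathEdges_add (θ : X → ℤ) (i k : ℤ) (L : List (X × Bool × H)) :
    pathEdges θ (i + k) L = (pathEdges θ i L).map fun p => (p.1, p.2 + k) := by
  induction L generalizing i with
  | nil => rfl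
  | cons t L ih =>
    rw [pathEdges, pathEdges, List.map_cons, ← ih, letterSrc_add, add_right_comm]

theorem pathEdges_append (θ : X → ℤ) (i : ℤ) (L L' : List (X × Bool × H)) :
    pathEdges θ i (L ++ L') = pathEdges θ i L ++ pathEdges θ (i + pathWt θ L) L' := by
  induction L generalizing i with
  | nil => simp [pathEdges]
  | cons t L ih => simp [pathEdges, ih, pathWt_cons, add_assoc]

theorem exists_getElem_of_mem_pathEdges (θ : X → ℤ) (i : ℤ) (L : List (X × Bool × H)) (p : X × ℤ)
    (hp : p ∈ pathEdges θ i L) :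
    ∃ (j : ℕ) (hj : j < L.length), p = (L[j].1, letterSrc θ (i + pathWt θ (L.take j)) L[j]) := by
  induction L generalizing i with
  | nil => simp [pathEdges] at hp
  | cons t L ih =>
    rcases List.mem_cons.1 hp with rfl | hp
    · exact ⟨0, by simp, by simp⟩
    · obtain ⟨j, hj, rfl⟩ := ih _ hp
      exact ⟨j + 1, by simpa using hj, by simp [pathWt_cons, add_assoc]⟩

variable [Group Γ] [Group H]

/-- The value of a letter read from the vertex `i`, for a labelling `e` of the edges. -/
def letterEval (θ : X → ℤ) (e : X → ℤ → Γ) (η : H →* Γ) (i : ℤ) (t : X × Bool × H) : Γ :=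
  (if t.2.1 then e t.1 (letterSrc θ i t) else (e t.1 (letterSrc θ i t))⁻¹) * η t.2.2

/-- The value of a relative word read from the vertex `i`, for a labelling `e` of the edges. -/
def pathEval (θ : X → ℤ) (e : X → ℤ → Γ) (η : H →* Γ) : ℤ → List (X × Bool × H) → Γ
  | _, [] => 1
  | i, t :: L => letterEval θ e η i t * pathEval θ e η (i + letterWt θ t) L

theorem pathEval_append (θ : X → ℤ) (e : X → ℤ → Γ) (η : H →* Γ) (i : ℤ)
    (L L' : List (X × Bool × H)) :
    pathEval θ e η i (L ++ L') = pathEval θ e η i L * pathEval θ e η (i + pathWt θ L) L' := by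
  induction L generalizing i with
  | nil => simp [pathEval]
  | cons t L ih => simp [pathEval, ih, pathWt_cons, add_assoc, mul_assoc]

theorem pathEval_congr (θ : X → ℤ) {e e' : X → ℤ → Γ} (η : H →* Γ) (i : ℤ)
    (L : List (X × Bool × H)) (h : ∀ p ∈ pathEdges θ i L, e p.1 p.2 = e' p.1 p.2) :
    pathEval θ e η i L = pathEval θ e' η i L := by
  induction L generalizing i with
  | nil => rfl
  | cons t L ih =>
    rw [pathEdges, List.forall_mem_cons] at h
    rw [pathEval, pathEval, ih _ h.2, letterEval, letterEval, h.1]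

theorem pathEval_shift (θ : X → ℤ) (e : X → ℤ → Γ) (η : H →* Γ) (i k : ℤ)
    (L : List (X × Bool × H)) :
    pathEval θ (fun x s => e x (s + k)) η i L = pathEval θ e η (i + k) L := by
  induction L generalizing i with
  | nil => rfl
  | cons t L ih =>
    rw [pathEval, pathEval, ih, letterEval, letterEval, letterSrc_add, add_right_comm]

theorem map_pathEval {Δ : Type*} [Group Δ] (κ : Γ →* Δ) (θ : X → ℤ) (e : X → ℤ → Γ) (η : H →* Γ)
    (i : ℤ) (L : List (X × Bool × H)) :
    κ (pathEval θ e η i L) = pathEval θ (fun x s => κ (e x s)) (κ.comp η) i L := by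
  induction L generalizing i with
  | nil => simp [pathEval]
  | cons t L ih =>
    rw [pathEval, pathEval, map_mul, ih, letterEval, letterEval, map_mul]
    split_ifs <;> simp

/-- For a labelling that is constant along each edge type, `pathEval` is evaluation in the free
product. -/
theorem pathEval_const (θ : X → ℤ) (f : X → Γ) (η : H →* Γ) (i : ℤ) (L : List (X × Bool × H)) :
    pathEval θ (fun x _ => f x) η i L = Coprod.lift η (FreeGroup.lift f) (relWord L) := by
  induction L generalizing i with
  | nil => simp [pathEval, relWord]
  | cons t L ih =>
    rw [pathEval, ih]
    obtain ⟨x, ε, h⟩ := t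
    cases ε <;> simp [letterEval, relWord]

/-- The equation `pathEval = 1` can be solved for the label of an edge that is traversed just
once. -/
theorem exists_pathEval_eq_one (θ : X → ℤ) (e : X → ℤ → Γ) (η : H →* Γ) (i : ℤ)
    (A B : List (X × Bool × H)) (t : X × Bool × H) :
    ∃ y, ∀ e' : X → ℤ → Γ, e' t.1 (letterSrc θ (i + pathWt θ A) t) = y →
      (∀ p ∈ pathEdges θ i A, e' p.1 p.2 = e p.1 p.2) →
      (∀ p ∈ pathEdges θ (i + pathWt θ A + letterWt θ t) B, e' p.1 p.2 = e p.1 p.2) →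
      pathEval θ e' η i (A ++ t :: B) = 1 := by
  set α := pathEval θ e η i A
  set β := pathEval θ e η (i + pathWt θ A + letterWt θ t) B
  refine ⟨if t.2.1 then α⁻¹ * β⁻¹ * (η t.2.2)⁻¹ else η t.2.2 * β * α, fun e' hy hA hB => ?_⟩
  rw [pathEval_append, pathEval, pathEval_congr θ η i A hA, pathEval_congr θ η _ B hB, letterEval,
    hy]
  change α * (_ * β) = 1
  split_ifs <;> group

theorem eq_of_pathEval_eq_one (θ : X → ℤ) {e e' : X → ℤ → Γ} (η : H →* Γ) (i : ℤ)
    (A B : List (X × Bool × H)) (t : X × Bool × H)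
    (hA : ∀ p ∈ pathEdges θ i A, e p.1 p.2 = e' p.1 p.2)
    (hB : ∀ p ∈ pathEdges θ (i + pathWt θ A + letterWt θ t) B, e p.1 p.2 = e' p.1 p.2)
    (he : pathEval θ e η i (A ++ t :: B) = 1) (he' : pathEval θ e' η i (A ++ t :: B) = 1) :
    e t.1 (letterSrc θ (i + pathWt θ A) t) = e' t.1 (letterSrc θ (i + pathWt θ A) t) := by
  rw [← he', pathEval_append, pathEval_append, pathEval, pathEval, pathEval_congr θ η i A hA,
    pathEval_congr θ η _ B hB, mul_right_inj, mul_left_inj, letterEval, letterEval,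
    mul_left_inj] at he
  split_ifs at he
  · exact he
  · exact inv_injective he

end Path

section MaxMin

variable {X H Γ : Type*}

/-- Reading `R` from the vertex `0` one stays between the vertices `m` and `M`, traverses just one
edge of type `a` with upper endpoint `M`, just one edge of type `b` with lower endpoint `m`, and
each of these two edges just once. -/
structure IsMaxMin (θ : X → ℤ) (R : List (X × Bool × H)) (a b : X) (m M : ℤ) : Prop where
  ne : a ≠ b
  pathWt_eq : pathWt θ R = 0
  lo : ∀ p ∈ pathEdges θ 0 R, m ≤ edgeLo θ p
  hi : ∀ p ∈ pathEdges θ 0 R, edgeHi θ p ≤ M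
  top : ∃ A t B, R = A ++ t :: B ∧ t.1 = a ∧ edgeHi θ (a, letterSrc θ (pathWt θ A) t) = M ∧
    ∀ p ∈ pathEdges θ 0 A ++ pathEdges θ (pathWt θ A + letterWt θ t) B, p.1 = a → edgeHi θ p ≠ M
  bot : ∃ A t B, R = A ++ t :: B ∧ t.1 = b ∧ edgeLo θ (b, letterSrc θ (pathWt θ A) t) = m ∧
    ∀ p ∈ pathEdges θ 0 A ++ pathEdges θ (pathWt θ A + letterWt θ t) B, p.1 = b → edgeLo θ p ≠ m

/-- The labelling of the edges in which the edges of types `a` and `b` carry the entries of a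
single sequence `u`, and all others are labelled by their type. -/
noncomputable def edgeLabel (θ : X → ℤ) (a b : X) (c : ℤ) (f : X → Γ) (u : ℤ → Γ) (x : X) (s : ℤ) :
    Γ :=
  open Classical in
  if x = a then u (edgeHi θ (x, s)) else if x = b then u (edgeLo θ (x, s) - c) else f x

theorem edgeLabel_shift (θ : X → ℤ) (a b : X) (c : ℤ) (f : X → Γ) (u : ℤ → Γ) (k : ℤ) (x : X)
    (s : ℤ) :
    edgeLabel θ a b c f (fun j => u (j + k)) x s = edgeLabel θ a b c f u x (s + k) := by
  simp only [edgeLabel, edgeHi_add, edgeLo_add, add_sub_right_comm]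

theorem edgeLabel_congr (θ : X → ℤ) (a b : X) (c : ℤ) (f : X → Γ) {u u' : ℤ → Γ} (x : X) (s : ℤ)
    (h₁ : x = a → u (edgeHi θ (x, s)) = u' (edgeHi θ (x, s)))
    (h₂ : x = b → u (edgeLo θ (x, s) - c) = u' (edgeLo θ (x, s) - c)) :
    edgeLabel θ a b c f u x s = edgeLabel θ a b c f u' x s := by
  unfold edgeLabel
  split_ifs with ha hb
  · exact h₁ ha
  · exact h₂ hb
  · rfl

theorem map_edgeLabel {Δ : Type*} (κ : Γ → Δ) (θ : X → ℤ) (a b : X) (c : ℤ) (f : X → Γ)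
    (u : ℤ → Γ) (x : X) (s : ℤ) :
    κ (edgeLabel θ a b c f u x s) = edgeLabel θ a b c (κ ∘ f) (κ ∘ u) x s := by
  unfold edgeLabel
  split_ifs <;> rfl

variable {θ : X → ℤ} {R : List (X × Bool × H)} {a b : X} {m M : ℤ}

namespace IsMaxMin

theorem mem_bounds (hR : IsMaxMin θ R a b m M) {i : ℤ} {p : X × ℤ} (hp : p ∈ pathEdges θ i R) :
    i + m ≤ edgeLo θ p ∧ edgeLo θ p ≤ edgeHi θ p ∧ edgeHi θ p ≤ i + M := by
  have h := pathEdges_add θ 0 i R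
  rw [zero_add] at h
  rw [h] at hp
  obtain ⟨p, hp', rfl⟩ := List.mem_map.1 hp
  rw [edgeLo_add, edgeHi_add]
  have h₁ := hR.lo p hp'
  have h₂ := hR.hi p hp'
  have h₃ := edgeLo_le_edgeHi θ p
  simp only [Prod.mk.eta]
  omega

theorem exists_top (hR : IsMaxMin θ R a b m M) (i : ℤ) :
    ∃ A t B, R = A ++ t :: B ∧ t.1 = a ∧ edgeHi θ (a, letterSrc θ (i + pathWt θ A) t) = i + M ∧
      ∀ p ∈ pathEdges θ i A ++ pathEdges θ (i + pathWt θ A + letterWt θ t) B,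
        p ∈ pathEdges θ i R ∧ (p.1 = a → edgeHi θ p ≠ i + M) := by
  obtain ⟨A, t, B, rfl, ha, hM, h⟩ := hR.top
  refine ⟨A, t, B, rfl, ha, ?_, fun p hp => ⟨?_, fun hpa => ?_⟩⟩
  · rw [add_comm, letterSrc_add, edgeHi_add, hM, add_comm]
  · rw [pathEdges_append, pathEdges]
    rw [List.mem_append] at hp ⊢
    exact hp.imp_right (List.mem_cons_of_mem _)
  · have e : pathEdges θ i A ++ pathEdges θ (i + pathWt θ A + letterWt θ t) B =
        (pathEdges θ 0 A ++ pathEdges θ (pathWt θ A + letterWt θ t) B).map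
          fun p => (p.1, p.2 + i) := by
      rw [List.map_append, ← pathEdges_add, ← pathEdges_add, zero_add, add_assoc, add_comm i]
    rw [e] at hp
    obtain ⟨p, hp', rfl⟩ := List.mem_map.1 hp
    have := h p hp' hpa
    rw [edgeHi_add]
    simp only [Prod.mk.eta]
    omega

theorem exists_bot (hR : IsMaxMin θ R a b m M) (i : ℤ) :
    ∃ A t B, R = A ++ t :: B ∧ t.1 = b ∧ edgeLo θ (b, letterSrc θ (i + pathWt θ A) t) = i + m ∧
      ∀ p ∈ pathEdges θ i A ++ pathEdges θ (i + pathWt θ A + letterWt θ t) B,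
        p ∈ pathEdges θ i R ∧ (p.1 = b → edgeLo θ p ≠ i + m) := by
  obtain ⟨A, t, B, rfl, ha, hM, h⟩ := hR.bot
  refine ⟨A, t, B, rfl, ha, ?_, fun p hp => ⟨?_, fun hpa => ?_⟩⟩
  · rw [add_comm, letterSrc_add, edgeLo_add, hM, add_comm]
  · rw [pathEdges_append, pathEdges]
    rw [List.mem_append] at hp ⊢
    exact hp.imp_right (List.mem_cons_of_mem _)
  · have e : pathEdges θ i A ++ pathEdges θ (i + pathWt θ A + letterWt θ t) B =
        (pathEdges θ 0 A ++ pathEdges θ (pathWt θ A + letterWt θ t) B).map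
          fun p => (p.1, p.2 + i) := by
      rw [List.map_append, ← pathEdges_add, ← pathEdges_add, zero_add, add_assoc, add_comm i]
    rw [e] at hp
    obtain ⟨p, hp', rfl⟩ := List.mem_map.1 hp
    have := h p hp' hpa
    rw [edgeLo_add]
    simp only [Prod.mk.eta]
    omega

variable [Group H] [Group Γ]

/-- The relators of the infinite cyclic cover form a two-sided recursion for the labels. -/
theorem isTwoSidedRecursion (hR : IsMaxMin θ R a b m M) {c : ℤ} (hc : 0 < c) (f : X → Γ)
    (η : H →* Γ) :
    IsTwoSidedRecursion (m - c) M
      fun i u => pathEval θ (edgeLabel θ a b c f u) η i R = 1 where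
  lt := by
    obtain ⟨A, t, B, rfl, -, -, -⟩ := hR.exists_top 0
    have := hR.mem_bounds (i := 0) (p := (t.1, letterSrc θ (0 + pathWt θ A) t))
      (by simp [pathEdges_append, pathEdges])
    omega
  congr i u u' h hu := by
    rw [← hu]
    refine pathEval_congr θ η i R fun p hp => ?_
    have := hR.mem_bounds hp
    exact edgeLabel_congr θ a b c f _ _ (fun _ => (h _ (by simp only [Prod.mk.eta]; omega)
      (by simp only [Prod.mk.eta]; omega)).symm) fun _ => (h _ (by simp only [Prod.mk.eta]; omega)
      (by simp only [Prod.mk.eta]; omega)).symm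
  exists_top i u := by
    obtain ⟨A, t, B, rfl, ha, hM, h⟩ := hR.exists_top i
    obtain ⟨y, hy⟩ := exists_pathEval_eq_one θ (edgeLabel θ a b c f u) η i A B t
    have key : ∀ p ∈ pathEdges θ i A ++ pathEdges θ (i + pathWt θ A + letterWt θ t) B,
        edgeLabel θ a b c f (Function.update u (i + M) y) p.1 p.2 =
          edgeLabel θ a b c f u p.1 p.2 := by
      intro p hp
      have := hR.mem_bounds (h p hp).1
      refine edgeLabel_congr θ a b c f _ _ (fun hpa => ?_) fun _ => ?_
      · exact Function.update_of_ne ((h p hp).2 hpa) _ _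
      · exact Function.update_of_ne (by simp only [Prod.mk.eta]; omega) _ _
    refine ⟨y, hy _ ?_ (fun p hp => key p (List.mem_append_left _ hp))
      fun p hp => key p (List.mem_append_right _ hp)⟩
    simp [edgeLabel, ha, hM]
  unique_top i u u' h hu hu' := by
    obtain ⟨A, t, B, rfl, ha, hM, hAB⟩ := hR.exists_top i
    have key : ∀ p ∈ pathEdges θ i A ++ pathEdges θ (i + pathWt θ A + letterWt θ t) B,
        edgeLabel θ a b c f u p.1 p.2 = edgeLabel θ a b c f u' p.1 p.2 := by
      intro p hp
      have := hR.mem_bounds (hAB p hp).1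
      refine edgeLabel_congr θ a b c f _ _ (fun hpa => h _ ?_ ?_) fun _ => h _ ?_ ?_
      · simp only [Prod.mk.eta]; omega
      · exact lt_of_le_of_ne this.2.2 ((hAB p hp).2 hpa)
      · simp only [Prod.mk.eta]; omega
      · simp only [Prod.mk.eta]; omega
    have := eq_of_pathEval_eq_one θ η i A B t (fun p hp => key p (List.mem_append_left _ hp))
      (fun p hp => key p (List.mem_append_right _ hp)) hu hu'
    simpa [edgeLabel, ha, hM] using this
  exists_bot i u := by
    obtain ⟨A, t, B, rfl, hb, hm, h⟩ := hR.exists_bot i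
    obtain ⟨y, hy⟩ := exists_pathEval_eq_one θ (edgeLabel θ a b c f u) η i A B t
    have key : ∀ p ∈ pathEdges θ i A ++ pathEdges θ (i + pathWt θ A + letterWt θ t) B,
        edgeLabel θ a b c f (Function.update u (i + (m - c)) y) p.1 p.2 =
          edgeLabel θ a b c f u p.1 p.2 := by
      intro p hp
      have := hR.mem_bounds (h p hp).1
      refine edgeLabel_congr θ a b c f _ _ (fun _ => ?_) fun hpb => ?_
      · exact Function.update_of_ne (by simp only [Prod.mk.eta]; omega) _ _
      · have := (h p hp).2 hpb
        exact Function.update_of_ne (by simp only [Prod.mk.eta]; omega) _ _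
    refine ⟨y, hy _ ?_ (fun p hp => key p (List.mem_append_left _ hp))
      fun p hp => key p (List.mem_append_right _ hp)⟩
    simp [edgeLabel, hb, hm, hR.ne.symm, add_sub_assoc]
  unique_bot i u u' h hu hu' := by
    obtain ⟨A, t, B, rfl, hb, hm, hAB⟩ := hR.exists_bot i
    have key : ∀ p ∈ pathEdges θ i A ++ pathEdges θ (i + pathWt θ A + letterWt θ t) B,
        edgeLabel θ a b c f u p.1 p.2 = edgeLabel θ a b c f u' p.1 p.2 := by
      intro p hp
      have := hR.mem_bounds (hAB p hp).1
      refine edgeLabel_congr θ a b c f _ _ (fun _ => h _ ?_ ?_) fun hpb => h _ ?_ ?_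
      · simp only [Prod.mk.eta]; omega
      · simp only [Prod.mk.eta]; omega
      · have := (hAB p hp).2 hpb
        simp only [Prod.mk.eta]; omega
      · simp only [Prod.mk.eta]; omega
    have := eq_of_pathEval_eq_one θ η i A B t (fun p hp => key p (List.mem_append_left _ hp))
      (fun p hp => key p (List.mem_append_right _ hp)) hu hu'
    simpa [edgeLabel, hb, hm, hR.ne.symm, add_sub_assoc] using this

end IsMaxMin

end MaxMin

section Extraction

variable {X H : Type*}

/-- A closed lattice walk with a unique maximum (at time `k + 1`) meets its maximum exactly during
the steps `k` and `k + 1`, cyclically. -/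
theorem max_step_of_unique_max {r : ℕ} {ψ : ℕ → ℤ} (h₀ : ψ r = ψ 0) {k : ℕ} (hkr : k < r)
    (hk : ∀ j < r, j ≠ k → ψ (j + 1) < ψ (k + 1)) {j : ℕ} (hj : j < r) :
    max (ψ j) (ψ (j + 1)) ≤ ψ (k + 1) ∧
      (max (ψ j) (ψ (j + 1)) = ψ (k + 1) ↔ j = k ∨ j = (k + 1) % r) := by
  have hle : ∀ j < r, ψ (j + 1) ≤ ψ (k + 1) ∧ (ψ (j + 1) = ψ (k + 1) ↔ j = k) := by
    intro j hj
    by_cases h : j = k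
    · simp [h]
    · have := hk j hj h
      exact ⟨this.le, by constructor <;> intro <;> omega⟩
  have hψ : ψ j ≤ ψ (k + 1) ∧ (ψ j = ψ (k + 1) ↔ j = (k + 1) % r) := by
    have hmod : (k + 1) % r = if k + 1 = r then 0 else k + 1 := by
      split_ifs with h
      · simp [h]
      · exact Nat.mod_eq_of_lt (by omega)
    rw [hmod]
    rcases j with _ | j
    · obtain ⟨r, rfl⟩ : ∃ s, r = s + 1 := ⟨r - 1, by omega⟩
      rw [← h₀]
      have := hle r (by omega)
      refine ⟨this.1, this.2.trans ?_⟩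
      by_cases h : k = r
      · simp [h]
      · simp [h, Ne.symm h]
    · have := hle j (by omega)
      refine ⟨this.1, this.2.trans ?_⟩
      by_cases h : k + 1 = r
      · simp only [h, if_true]
        omega
      · simp only [h, if_false]
        omega
  have := hle j hj
  refine ⟨max_le hψ.1 this.1, ?_⟩
  rw [← this.2, ← hψ.2]
  omega

variable (θ : X → ℤ) (R : List (X × Bool × H))

/-- The edge traversed by the letter of `R` in position `j`. -/
def stepEdge (j : ℕ) (hj : j < R.length) : X × ℤ :=
  (R[j].1, letterSrc θ (pathWt θ (R.take j)) R[j])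

theorem pathWt_take_succ {j : ℕ} (hj : j < R.length) :
    pathWt θ (R.take (j + 1)) = pathWt θ (R.take j) + letterWt θ R[j] := by
  rw [List.take_add_one, List.getElem?_eq_getElem hj, pathWt_append]
  simp [pathWt]

theorem edgeHi_stepEdge {j : ℕ} (hj : j < R.length) :
    edgeHi θ (stepEdge θ R j hj) = max (pathWt θ (R.take j)) (pathWt θ (R.take (j + 1))) := by
  rw [stepEdge, edgeHi_letter, pathWt_take_succ]

theorem edgeLo_stepEdge {j : ℕ} (hj : j < R.length) :
    edgeLo θ (stepEdge θ R j hj) = min (pathWt θ (R.take j)) (pathWt θ (R.take (j + 1))) := by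
  rw [stepEdge, edgeLo_letter, pathWt_take_succ]

theorem exists_stepEdge_of_mem {p : X × ℤ} (hp : p ∈ pathEdges θ 0 R) :
    ∃ (j : ℕ) (hj : j < R.length), p = stepEdge θ R j hj := by
  obtain ⟨j, hj, rfl⟩ := exists_getElem_of_mem_pathEdges θ 0 R p hp
  exact ⟨j, hj, by simp [stepEdge]⟩

/-- Cutting out the letter in position `k` leaves the edges traversed at the other steps. -/
theorem exists_stepEdge_of_mem_cut {k : ℕ} (hk : k < R.length) {p : X × ℤ}
    (hp : p ∈ pathEdges θ 0 (R.take k) ++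
      pathEdges θ (pathWt θ (R.take k) + letterWt θ R[k]) (R.drop (k + 1))) :
    ∃ (j : ℕ) (hj : j < R.length), j ≠ k ∧ p = stepEdge θ R j hj := by
  rcases List.mem_append.1 hp with hp | hp
  · obtain ⟨j, hj, rfl⟩ := exists_getElem_of_mem_pathEdges θ _ _ p hp
    rw [List.length_take] at hj
    have hjk : j ≤ k := by omega
    refine ⟨j, by omega, by omega, ?_⟩
    simp [stepEdge, List.take_take, hjk]
  · obtain ⟨j, hj, rfl⟩ := exists_getElem_of_mem_pathEdges θ _ _ p hp
    rw [List.length_drop] at hj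
    refine ⟨k + 1 + j, by omega, by omega, ?_⟩
    rw [← pathWt_take_succ, ← pathWt_append, ← List.take_add]
    simp [stepEdge]

theorem phiW_skel (j : ℕ) : phiW θ (skel R) j = pathWt θ (R.take j) := by
  unfold phiW skel pathWt letterWt
  rw [← List.map_take, List.map_map]
  rfl

variable {θ R}

theorem exists_isMaxMin (h : UniqueMaxMinWith θ (skel R)) :
    ∃ a b m M, IsMaxMin θ R a b m M := by
  obtain ⟨-, -, -, hadm, ⟨k, hkr⟩, ⟨l, hlr⟩, hk, hl, hk', hl'⟩ := h
  have hlen : (skel R).length = R.length := by simp [skel]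
  simp only [phiW_skel, succIdx, List.get_eq_getElem, ne_eq, Fin.mk.injEq, Fin.forall_iff,
    hlen] at hk hl hk' hl'
  rw [hlen] at hkr hlr
  have hwt : pathWt θ R = 0 := by
    unfold IsAdmissible at hadm
    rw [phiW_skel, hlen, List.take_length] at hadm
    exact hadm
  set ψ : ℕ → ℤ := fun j => pathWt θ (R.take j) with hψ
  have h₀ : ψ R.length = ψ 0 := by simp [hψ, hwt]
  have hmax := fun j hj => max_step_of_unique_max (j := j) h₀ hkr hk hj
  have hmin : ∀ j < R.length, ψ (l + 1) ≤ min (ψ j) (ψ (j + 1)) ∧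
      (min (ψ j) (ψ (j + 1)) = ψ (l + 1) ↔ j = l ∨ j = (l + 1) % R.length) := by
    intro j hj
    have := max_step_of_unique_max (ψ := fun j => -ψ j) (j := j) (by simpa using h₀) hlr
      (fun j hj hjl => neg_lt_neg (hl j hj hjl)) hj
    rw [← this.2]
    have := this.1
    constructor <;> [skip; constructor] <;> intros <;> omega
  have hpos : 0 < R.length := by omega
  have hk₁ : (k + 1) % R.length < R.length := Nat.mod_lt _ hpos
  have hl₁ : (l + 1) % R.length < R.length := Nat.mod_lt _ hpos
  replace hk' : R[k].1 ≠ R[(k + 1) % R.length].1 := by simpa [skel] using hk'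
  replace hl' : R[l].1 ≠ R[(l + 1) % R.length].1 := by simpa [skel] using hl'
  obtain ⟨lb, hlb, hlb', hne⟩ : ∃ (lb : ℕ) (hlb : lb < R.length),
      (lb = l ∨ lb = (l + 1) % R.length) ∧ R[k].1 ≠ R[lb].1 := by
    by_cases h : R[k].1 = R[l].1
    · exact ⟨_, hl₁, Or.inr rfl, h ▸ hl'⟩
    · exact ⟨l, hlr, Or.inl rfl, h⟩
  have hcut : ∀ n (hn : n < R.length), R = R.take n ++ R[n] :: R.drop (n + 1) := fun n hn => by
    rw [← List.drop_eq_getElem_cons hn, List.take_append_drop]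
  refine ⟨R[k].1, R[lb].1, ψ (l + 1), ψ (k + 1), hne, hwt, fun p hp => ?_, fun p hp => ?_,
    ⟨_, _, _, hcut k hkr, rfl, ?_, fun p hp hpa hpM => ?_⟩,
    ⟨_, _, _, hcut lb hlb, rfl, ?_, fun p hp hpb hpm => ?_⟩⟩
  · obtain ⟨j, hj, rfl⟩ := exists_stepEdge_of_mem θ R hp
    rw [edgeLo_stepEdge]
    exact (hmin j hj).1
  · obtain ⟨j, hj, rfl⟩ := exists_stepEdge_of_mem θ R hp
    rw [edgeHi_stepEdge]
    exact (hmax j hj).1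
  · exact (edgeHi_stepEdge θ R hkr).trans ((hmax k hkr).2.2 (Or.inl rfl))
  · obtain ⟨j, hj, hjk, rfl⟩ := exists_stepEdge_of_mem_cut θ R hkr hp
    rw [edgeHi_stepEdge] at hpM
    rcases (hmax j hj).2.1 hpM with rfl | rfl
    · exact hjk rfl
    · exact hk' hpa.symm
  · exact (edgeLo_stepEdge θ R hlb).trans ((hmin lb hlb).2.2 hlb')
  · obtain ⟨j, hj, hjl, rfl⟩ := exists_stepEdge_of_mem_cut θ R hlb hp
    rw [edgeLo_stepEdge] at hpm
    rcases (hmin j hj).2.1 hpm with rfl | rfl <;> rcases hlb' with rfl | rfl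
    · exact hjl rfl
    · exact hl' hpb
    · exact hl' hpb.symm
    · exact hjl rfl

end Extraction

section Action

variable {X H Γ : Type*} [Group H] [Group Γ]

/-- The label sequences satisfying all relators of the infinite cyclic cover. -/
def LabelSolution (θ : X → ℤ) (R : List (X × Bool × H)) (a b : X) (c : ℤ) (f : X → Γ)
    (η : H →* Γ) : Type _ :=
  {u : ℤ → Γ // ∀ i, pathEval θ (edgeLabel θ a b c f u) η i R = 1}

namespace LabelSolution

variable {θ : X → ℤ} {R : List (X × Bool × H)} {a b : X} {c : ℤ} {f : X → Γ} {η : H →* Γ}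

/-- The labelling of the edges given by a solution. -/
noncomputable def label (s : LabelSolution θ R a b c f η) : X → ℤ → Γ := edgeLabel θ a b c f s.1

/-- The deck transformations act on the solutions. -/
def shift (k : ℤ) (s : LabelSolution θ R a b c f η) : LabelSolution θ R a b c f η :=
  ⟨fun j => s.1 (j + k), fun i => by
    have := pathEval_shift θ (edgeLabel θ a b c f s.1) η i k R
    simp only [← edgeLabel_shift] at this
    exact this.trans (s.2 _)⟩

theorem label_shift (k : ℤ) (s : LabelSolution θ R a b c f η) :
    (s.shift k).label = fun x i => s.label x (i + k) := by
  ext x i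
  exact edgeLabel_shift θ a b c f s.1 k x i

@[simp] theorem shift_zero (s : LabelSolution θ R a b c f η) : s.shift 0 = s :=
  Subtype.ext (by simp [shift])

@[simp] theorem shift_shift (k l : ℤ) (s : LabelSolution θ R a b c f η) :
    (s.shift k).shift l = s.shift (k + l) :=
  Subtype.ext (by ext j; simp [shift, add_assoc, add_comm l])

theorem finite {m M : ℤ} (hR : IsMaxMin θ R a b m M) (hc : 0 < c) [Finite Γ] :
    Finite (LabelSolution θ R a b c f η) := by
  refine Finite.of_injective (β := Set.Ico (m - c) M → Γ) (fun s j => s.1 j) fun s s' h => ?_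
  exact Subtype.ext ((hR.isTwoSidedRecursion hc f η).eq_of_window
    (fun j h₁ h₂ => congrFun h ⟨j, h₁, h₂⟩) s.2 s'.2)

variable (θ R a b c f η)

/-- The permutation induced by a generator. -/
noncomputable def genPerm (x : X) : Equiv.Perm (LabelSolution θ R a b c f η × Γ) where
  toFun z := (z.1.shift (-θ x), (z.1.shift (-θ x)).label x 0 * z.2)
  invFun z := (z.1.shift (θ x), (z.1.label x 0)⁻¹ * z.2)
  left_inv z := by simp
  right_inv z := by simp

/-- The permutations induced by the coefficient group. -/
def coeffPerm : H →* Equiv.Perm (LabelSolution θ R a b c f η × Γ) :=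
  (mulLeftPerm _ Γ).comp η

/-- The action of the free product on pairs of a solution and an element of `Γ`. -/
noncomputable def freeAction :
    Coprod H (FreeGroup X) →* Equiv.Perm (LabelSolution θ R a b c f η × Γ) :=
  Coprod.lift (coeffPerm θ R a b c f η) (FreeGroup.lift (genPerm θ R a b c f η))

theorem freeAction_inl (h : H) (s : LabelSolution θ R a b c f η) (γ : Γ) :
    freeAction θ R a b c f η (Coprod.inl h) (s, γ) = (s, η h * γ) := rfl

theorem freeAction_letter (t : X × Bool × H) (s : LabelSolution θ R a b c f η) (γ : Γ) :
    freeAction θ R a b c f η (Coprod.inr (FreeGroup.mk [(t.1, t.2.1)]) * Coprod.inl t.2.2)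
      (s.shift (letterWt θ t), γ) = (s, letterEval θ s.label η 0 t * γ) := by
  obtain ⟨x, ε, h⟩ := t
  rw [map_mul, Equiv.Perm.mul_apply, freeAction_inl]
  cases ε
  · simp [freeAction, genPerm, letterWt, letterEval, letterSrc, Equiv.Perm.inv_def, label_shift,
      mul_assoc]
  · simp [freeAction, genPerm, letterWt, letterEval, letterSrc, mul_assoc]

theorem freeAction_relWord (L : List (X × Bool × H)) (s : LabelSolution θ R a b c f η) (γ : Γ) :
    freeAction θ R a b c f η (relWord L) (s.shift (pathWt θ L), γ) =
      (s, pathEval θ s.label η 0 L * γ) := by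
  induction L generalizing s with
  | nil => simp [relWord, pathEval]
  | cons t L ih =>
    have e : relWord (t :: L) =
      (Coprod.inr (FreeGroup.mk [(t.1, t.2.1)]) * Coprod.inl t.2.2) * relWord L := by
      simp [relWord]
    rw [e, map_mul, Equiv.Perm.mul_apply, pathWt_cons, ← shift_shift, ih, freeAction_letter,
      pathEval, label_shift, pathEval_shift, mul_assoc, zero_add]

variable {θ R}

/-- The action of the free product descends to the relative one-relator group. -/
noncomputable def relAction (hR : pathWt θ R = 0) :
    relGroup R →* Equiv.Perm (LabelSolution θ R a b c f η × Γ) :=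
  QuotientGroup.lift _ (freeAction θ R a b c f η) (by
    have h : Subgroup.normalClosure {relWord R} ≤ (freeAction θ R a b c f η).ker := by
      refine Subgroup.normalClosure_le_normal (Set.singleton_subset_iff.2 ?_)
      refine Equiv.ext fun ⟨s, γ⟩ => ?_
      have := freeAction_relWord θ R a b c f η R s γ
      rw [hR, shift_zero] at this
      rw [this]
      change (s, pathEval θ (edgeLabel θ a b c f s.1) η 0 R * γ) = (s, γ)
      rw [s.2, one_mul]
    exact h)

theorem relAction_mk (hR : pathWt θ R = 0) (g : Coprod H (FreeGroup X)) :
    relAction a b c f η hR (QuotientGroup.mk g : relGroup R) = freeAction θ R a b c f η g := rfl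

end LabelSolution

end Action

section Main

variable {X H : Type*}

theorem exists_eq_inl_mul_relWord [Group H] (g : Coprod H (FreeGroup X)) :
    ∃ (h : H) (L : List (X × Bool × H)), g = Coprod.inl h * relWord L := by
  induction g using Coprod.induction_on' with
  | one => exact ⟨1, [], by simp [relWord]⟩
  | inl_mul h₀ g ih =>
    obtain ⟨h, L, rfl⟩ := ih
    exact ⟨h₀ * h, L, by simp [mul_assoc]⟩
  | inr_mul w g ih =>
    obtain ⟨l, rfl⟩ : ∃ l, FreeGroup.mk l = w := Quot.exists_rep w
    induction l with
    | nil =>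
      obtain ⟨h, L, rfl⟩ := ih
      exact ⟨h, L, by rw [← FreeGroup.one_eq_mk, map_one, one_mul]⟩
    | cons t l ihl =>
      obtain ⟨h, L, hL⟩ := ihl
      refine ⟨1, (t.1, t.2, h) :: L, ?_⟩
      have : (FreeGroup.mk (t :: l) : FreeGroup X) = FreeGroup.mk [t] * FreeGroup.mk l := by simp
      rw [this, map_mul, mul_assoc, hL]
      simp [relWord, mul_assoc]

/-- A relative word has bounded height. -/
theorem exists_edge_bound (θ : X → ℤ) (L : List (X × Bool × H)) :
    ∃ B : ℤ, 0 ≤ B ∧ ∀ p ∈ pathEdges θ 0 L, -B ≤ edgeLo θ p ∧ edgeHi θ p ≤ B := by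
  generalize pathEdges θ 0 L = l
  induction l with
  | nil => exact ⟨0, le_rfl, by simp⟩
  | cons p l ih =>
    obtain ⟨B, hB, h⟩ := ih
    refine ⟨B + |edgeLo θ p| + |edgeHi θ p|, by positivity, fun p' hp' => ?_⟩
    have h₁ := neg_abs_le (edgeLo θ p)
    have h₂ := le_abs_self (edgeHi θ p)
    have h₃ := abs_nonneg (edgeLo θ p)
    have h₄ := abs_nonneg (edgeHi θ p)
    rcases List.mem_cons.1 hp' with rfl | hp'
    · constructor <;> omega
    · have := h p' hp'
      constructor <;> omega

/-- A labelling sequence that interpolates between the constant labels of `b` and of `a` labels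
the edges far enough inside a window by their types. -/
theorem edgeLabel_eq_of_window {Γ : Type*} (θ : X → ℤ) {a b : X} (m c : ℤ) (f : X → Γ)
    {u : ℤ → Γ} {p : X × ℤ}
    (hu : ∀ j, m - c ≤ j → j < m + c → u j = if j < m then f b else f a)
    (h₁ : m ≤ edgeLo θ p) (h₂ : edgeHi θ p < m + c) :
    edgeLabel θ a b c f u p.1 p.2 = f p.1 := by
  have := edgeLo_le_edgeHi θ p
  unfold edgeLabel
  simp only [Prod.mk.eta]
  split_ifs with ha hb
  · rw [hu _ (by omega) (by omega), if_neg (by omega), ha]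
  · rw [hu _ (by omega) (by omega), if_pos (by omega), hb]
  · rfl

variable [Group H] {R : List (X × Bool × H)} {θ : X → ℤ} {a b : X} {m M : ℤ}

theorem natHom_injective (hR : IsMaxMin θ R a b m M) : Function.Injective (natHom R) := by
  rw [injective_iff_map_eq_one]
  intro h hh
  obtain ⟨u, hu, -⟩ := (hR.isTwoSidedRecursion (c := 1) one_pos (fun _ => (1 : H))
    (MonoidHom.id H)).exists_solution fun _ => 1
  have key : LabelSolution.relAction a b 1 (fun _ => (1 : H)) (MonoidHom.id H) hR.pathWt_eq
      (natHom R h) (⟨u, hu⟩, 1) = (⟨u, hu⟩, h * 1) := rfl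
  rw [hh, map_one] at key
  simpa using (congrArg Prod.snd key).symm

/-- The group defined by the presentation is residually finite as soon as some residually finite
group containing labels for the coefficients and the generators maps compatibly onto it. -/
theorem residuallyFinite_relGroup_of_lift {Γ : Type*} [Group Γ] (hΓ : ResiduallyFinite Γ)
    (hR : IsMaxMin θ R a b m M) (η : H →* Γ) (f : X → Γ) (π : Γ →* relGroup R)
    (hη : ∀ h, π (η h) = QuotientGroup.mk (Coprod.inl h))
    (hf : ∀ x, π (f x) = QuotientGroup.mk (Coprod.inr (FreeGroup.of x))) :
    ResiduallyFinite (relGroup R) := by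
  intro g hg
  obtain ⟨g, rfl⟩ := QuotientGroup.mk_surjective g
  obtain ⟨h, L, rfl⟩ := exists_eq_inl_mul_relWord g
  have hlift : Coprod.lift (π.comp η) (FreeGroup.lift (π ∘ f)) =
      QuotientGroup.mk' (Subgroup.normalClosure {relWord R}) := by
    refine Coprod.hom_ext (MonoidHom.ext hη) (FreeGroup.ext_hom _ _ fun x => ?_)
    simp only [MonoidHom.comp_apply, Coprod.lift_apply_inr, FreeGroup.lift_apply_of]
    exact hf x
  obtain ⟨B, hB, hBL⟩ := exists_edge_bound θ L
  have hmM : m ≤ M := by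
    have := (hR.isTwoSidedRecursion one_pos f η).lt
    omega
  set c : ℤ := 2 * B + (M - m) + 1 with hc
  have hc₀ : 0 < c := by omega
  let v (j : ℤ) : Γ := if j < m then f b else f a
  obtain ⟨u, hu, huv⟩ := (hR.isTwoSidedRecursion hc₀ f η).exists_solution v
  have hwin : ∀ j, m - c ≤ j → j < m + c → (π ∘ u) j = if j < m then (π ∘ f) b else (π ∘ f) a := by
    intro j h₁ h₂
    refine (hR.isTwoSidedRecursion hc₀ (π ∘ f) (π.comp η)).eq_of_forward (c - (M - m)).toNat
      (u := π ∘ u) (u' := fun j => if j < m then (π ∘ f) b else (π ∘ f) a) (fun j h₁ h₂ => ?_)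
      (fun i h₁ h₂ => ?_) (fun i h₁ h₂ => ?_) j h₁ (by omega)
    · simp only [Function.comp_apply, huv j h₁ h₂, v]
      split_ifs <;> rfl
    · have := congrArg π (hu i)
      rw [map_pathEval, map_one] at this
      simpa only [map_edgeLabel] using this
    · rw [pathEval_congr θ (e' := fun x _ => (π ∘ f) x), pathEval_const, hlift]
      · exact (QuotientGroup.eq_one_iff _).2 (Subgroup.subset_normalClosure rfl)
      · intro p hp
        have := hR.mem_bounds hp
        exact edgeLabel_eq_of_window θ m c _ (fun _ _ _ => rfl) (by omega) (by omega)
  have hev : π (η h * pathEval θ (edgeLabel θ a b c f u) η (m + B) L) =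
      QuotientGroup.mk (Coprod.inl h * relWord L) := by
    rw [map_mul, map_pathEval, hη]
    simp only [map_edgeLabel]
    rw [pathEval_congr θ (e' := fun x _ => (π ∘ f) x), pathEval_const, hlift]
    · rfl
    · intro p hp
      rw [← zero_add (m + B), pathEdges_add] at hp
      obtain ⟨p, hp', rfl⟩ := List.mem_map.1 hp
      have := hBL p hp'
      refine edgeLabel_eq_of_window θ m c _ hwin ?_ ?_
      · rw [edgeLo_add]; simp only [Prod.mk.eta]; omega
      · rw [edgeHi_add]; simp only [Prod.mk.eta]; omega
  obtain ⟨Q, _, _, κ, hκ⟩ := hΓ (η h * pathEval θ (edgeLabel θ a b c f u) η (m + B) L)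
    fun h₁ => hg (by rw [← hev, h₁, map_one])
  have := LabelSolution.finite (f := κ ∘ f) (η := κ.comp η) hR hc₀
  let s₀ : LabelSolution θ R a b c (κ ∘ f) (κ.comp η) := ⟨κ ∘ u, fun i => by
    have := congrArg κ (hu i)
    rw [map_pathEval, map_one] at this
    simpa only [map_edgeLabel] using this⟩
  let s := s₀.shift (m + B)
  refine ⟨Equiv.Perm (LabelSolution θ R a b c (κ ∘ f) (κ.comp η) × Q), inferInstance,
    inferInstance, LabelSolution.relAction a b c _ _ hR.pathWt_eq, fun hone => hκ ?_⟩
  have key := LabelSolution.freeAction_relWord θ R a b c (κ ∘ f) (κ.comp η) L s 1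
  rw [LabelSolution.relAction_mk] at hone
  have hone' := DFunLike.congr_fun hone (s.shift (pathWt θ L), 1)
  rw [map_mul, Equiv.Perm.mul_apply, key, LabelSolution.freeAction_inl, LabelSolution.label_shift,
    pathEval_shift, zero_add, mul_one] at hone'
  have hsnd : κ (η h) * pathEval θ (edgeLabel θ a b c (κ ∘ f) (κ ∘ u)) (κ.comp η) (m + B) L = 1 :=
    congrArg Prod.snd hone'
  rw [map_mul, map_pathEval]
  simpa only [map_edgeLabel] using hsnd

theorem residuallyFinite_relGroup (hR : IsMaxMin θ R a b m M) (hH : ResiduallyFinite H) :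
    ResiduallyFinite (relGroup R) := by
  let K := H × Multiplicative ℤ
  let gen (x : X) : relGroup R := QuotientGroup.mk (Coprod.inr (FreeGroup.of x))
  let π (o : Option X) : K →* relGroup R := match o with
    | none => (natHom R).comp (MonoidHom.fst _ _)
    | some x => (zpowersHom _ (gen x)).comp (MonoidHom.snd _ _)
  refine residuallyFinite_relGroup_of_lift
    (residuallyFinite_coprodI (ι := Option X) (hH.prod residuallyFinite_multiplicative_int)) hR
    ((CoprodI.of (i := none)).comp (MonoidHom.inl H (Multiplicative ℤ)))
    (fun x => CoprodI.of (i := some x) (1, Multiplicative.ofAdd 1)) (CoprodI.lift π)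
    (fun h => ?_) fun x => ?_
  · simp [π, natHom]
    rfl
  · simp only [CoprodI.lift_of, π, MonoidHom.comp_apply]
    exact zpow_one (gen x)

end Main

/-- **Theorem 1(ii)** (Pride). If `P = ⟨x, H; R⟩` is a relative one-relator
presentation whose `x`-skeleton has the unique max-min property (an
`M_H`-presentation), then `G(P)` is residually finite iff `H` is. -/
theorem relGroup_residuallyFinite_iff_of_hasUniqueMaxMin {X H : Type*} [Group H]
    (R : List (X × Bool × H)) (hP : HasUniqueMaxMin (skel R)) :
    ResiduallyFinite (relGroup R) ↔ ResiduallyFinite H := by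
  obtain ⟨θ, hθ⟩ := hP
  obtain ⟨a, b, m, M, hR⟩ := exists_isMaxMin hθ
  exact ⟨fun h => h.of_injective (natHom R) (natHom_injective hR), residuallyFinite_relGroup hR⟩
end
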